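/- Let ω be a word of length k in [n] and let 1 ≤ j < k, with ω' = ω_1⋯ω_j its initial factor of length j. If η is a highest weight of ω and η' is a highest weight of ω', then η' = η_1⋯η_j, the initial factor of η of length j. -/

import Mathlib

/-! # Common definitions: words, crystal operators, perforated tableaux, RSK -/

/-- `phiL i s` is 1 if the letter `s` equals `i`, else 0. -/
def phiL (i s : ℕ) : ℤ := if s = i then 1 else 0

/-- `epsL i s` is 1 if the letter `s` equals `i+1`, else 0. -/
def epsL (i s : ℕ) : ℤ := if s = i + 1 then 1 else 0

/-- `c_e^i(w, j)`. -/
def ce (w : ℕ → ℕ) (i j : ℕ) : ℤ :=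
  (∑ s ∈ Finset.Icc 1 j, epsL i (w s)) - (∑ s ∈ Finset.Icc 1 (j - 1), phiL i (w s))

/-- `c_f^i(w, j)` for a word of length `k`. -/
def cf (k : ℕ) (w : ℕ → ℕ) (i j : ℕ) : ℤ :=
  (∑ s ∈ Finset.Icc j k, phiL i (w s)) - (∑ s ∈ Finset.Icc (j + 1) k, epsL i (w s))

/-- `E` is the value `ε_i(w)` (maximum of `c_e^i(w,j)` over `1 ≤ j ≤ k`). -/
def IsEps (k : ℕ) (w : ℕ → ℕ) (i : ℕ) (E : ℤ) : Prop :=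
  (∃ j ∈ Finset.Icc 1 k, ce w i j = E) ∧ ∀ j ∈ Finset.Icc 1 k, ce w i j ≤ E

/-- `F` is the value `φ_i(w)` (maximum of `c_f^i(w,j)` over `1 ≤ j ≤ k`). -/
def IsPhi (k : ℕ) (w : ℕ → ℕ) (i : ℕ) (F : ℤ) : Prop :=
  (∃ j ∈ Finset.Icc 1 k, cf k w i j = F) ∧ ∀ j ∈ Finset.Icc 1 k, cf k w i j ≤ F

/-- `Raises k i w w'` : `w' = e_i(w)` (in particular `e_i(w) ≠ NULL`). -/
def Raises (k i : ℕ) (w w' : ℕ → ℕ) : Prop :=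
  ∃ E : ℤ, ∃ j : ℕ, IsEps k w i E ∧ j ∈ Finset.Icc 1 k ∧ ce w i j = E ∧
    (∀ j' ∈ Finset.Icc 1 k, ce w i j' = E → j ≤ j') ∧
    w j = i + 1 ∧ w' = Function.update w j i

/-- `Lowers k i w w'` : `w' = f_i(w)` (in particular `f_i(w) ≠ NULL`). -/
def Lowers (k i : ℕ) (w w' : ℕ → ℕ) : Prop :=
  ∃ F : ℤ, ∃ j : ℕ, IsPhi k w i F ∧ j ∈ Finset.Icc 1 k ∧ cf k w i j = F ∧
    (∀ j' ∈ Finset.Icc 1 k, cf k w i j' = F → j' ≤ j) ∧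
    w j = i ∧ w' = Function.update w j (i + 1)

/-- `w` is a word of length `k` in the alphabet `[n] = {1,…,n}`. -/
def IsWord (n k : ℕ) (w : ℕ → ℕ) : Prop := ∀ s ∈ Finset.Icc 1 k, w s ∈ Finset.Icc 1 n

/-- The number of letters of `w` (of length `k`) equal to `a`: component `a` of `wt(w)`. -/
def wtc (k : ℕ) (w : ℕ → ℕ) (a : ℕ) : ℕ :=
  ((Finset.Icc 1 k).filter (fun s => w s = a)).card

/-- The biword `(τ, ω)` of length `k` is in standard form. -/
def StdForm (k : ℕ) (τ ω : ℕ → ℕ) : Prop :=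
  (∀ j, 1 ≤ j → j < k → τ j ≤ τ (j + 1)) ∧
  (∀ j, 1 ≤ j → j < k → τ j = τ (j + 1) → ω (j + 1) ≤ ω j)

/-- One application of some raising operator `e_i`, `1 ≤ i < n`. -/
def RaiseStep (n k : ℕ) (w w' : ℕ → ℕ) : Prop := ∃ i, 1 ≤ i ∧ i < n ∧ Raises k i w w'

/-- `η` is a highest weight of `w`: obtained from `w` by finitely many raising
operators, and no raising operator applies to `η`. -/
def HighestOf (n k : ℕ) (w η : ℕ → ℕ) : Prop :=
  Relation.ReflTransGen (RaiseStep n k) w η ∧ ∀ i, 1 ≤ i → i < n → ¬∃ η', Raises k i η η'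

/-! ## Perforated tableaux -/

/-- A rectangular array of optionally-filled boxes, indexed by (row, column), 1-based. -/
abbrev Arr : Type := ℕ → ℕ → Option ℕ

/-- Conditions (i) and (ii) for a perforated tableau with `n` rows, content in `[m]`,
`ℓ` columns (together with confinement of the filled boxes to the grid). -/
def PCond (n m ℓ : ℕ) (E : Arr) : Prop :=
  (∀ r c a, E r c = some a → 1 ≤ r ∧ r ≤ n ∧ 1 ≤ c ∧ c ≤ ℓ ∧ 1 ≤ a ∧ a ≤ m) ∧
  (∀ i r r' c, E r c = some i → E r' c = some i → r = r') ∧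
  (∀ i r c r' c', E r c = some i → E r' c' = some i → c < c' → r' ≤ r) ∧
  (∀ i j r c r' c', i < j → E r c = some i → E r' c' = some j → r ≤ r' ∧ c ≤ c')

/-- The number of boxes of `E` (with `ℓ` columns) filled with `a` lying in row `r`. -/
def cnt (ℓ : ℕ) (E : Arr) (a r : ℕ) : ℕ :=
  ((Finset.Icc 1 ℓ).filter (fun c => E r c = some a)).card

/-- `E` is a perforated tableau with `n` rows, content in `[m]` and `ℓ` columns:
conditions (i), (ii) hold and `ℓ` is minimal for the given (value, row) multiplicities. -/
def IsPTab (n m ℓ : ℕ) (E : Arr) : Prop :=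
  PCond n m ℓ E ∧
  ∀ ℓ' (E' : Arr), PCond n m ℓ' E' → (∀ a r, cnt ℓ' E' a r = cnt ℓ E a r) → ℓ ≤ ℓ'

/-- One swap of a blank box with a horizontally adjacent filled box in the same row,
both `E` and the result `E'` being valid ptableaux. -/
def SwapStep (n m ℓ : ℕ) (E E' : Arr) : Prop :=
  IsPTab n m ℓ E ∧ IsPTab n m ℓ E' ∧
  ∃ r c,
    ((E r c = none ∧ E r (c + 1) ≠ none ∧ E' r c = E r (c + 1) ∧ E' r (c + 1) = none) ∨
     (E r (c + 1) = none ∧ E r c ≠ none ∧ E' r (c + 1) = E r c ∧ E' r c = none)) ∧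
    ∀ r' c', ¬(r' = r ∧ (c' = c ∨ c' = c + 1)) → E' r' c' = E r' c'

/-- Row-equivalence of ptableaux: finitely many swap steps. -/
def RowEquiv (n m ℓ : ℕ) : Arr → Arr → Prop := Relation.ReflTransGen (SwapStep n m ℓ)

/-- Number of filled boxes in row `r` among columns `1..c` (inclusive). -/
def filledUpTo (E : Arr) (r c : ℕ) : ℕ :=
  ((Finset.Icc 1 c).filter (fun c' => E r c' ≠ none)).card

/-- `E` is left-justified: its filled boxes lie weakly to the left of the corresponding
boxes of any row-equivalent ptableau. -/
def LeftJust (n m ℓ : ℕ) (E : Arr) : Prop :=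
  IsPTab n m ℓ E ∧ ∀ E', RowEquiv n m ℓ E E' → ∀ r c, filledUpTo E' r c ≤ filledUpTo E r c

/-- `E` is right-justified. -/
def RightJust (n m ℓ : ℕ) (E : Arr) : Prop :=
  IsPTab n m ℓ E ∧ ∀ E', RowEquiv n m ℓ E E' → ∀ r c, filledUpTo E r c ≤ filledUpTo E' r c

/-- Number of blank boxes in row `r`, among columns `1..ℓ`. -/
def blanksInRow (ℓ : ℕ) (E : Arr) (r : ℕ) : ℕ :=
  ((Finset.Icc 1 ℓ).filter (fun c => E r c = none)).card

/-- `G` (with `ℓ2` columns) is the left-justified form `^*T[i,i+1]` of the two-row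
ptableau formed by rows `i`, `i+1` of `E` (a ptableau with `ℓ` columns). -/
def IsLJ2 (m ℓ : ℕ) (E : Arr) (i : ℕ) (G : Arr) (ℓ2 : ℕ) : Prop :=
  IsPTab 2 m ℓ2 G ∧ LeftJust 2 m ℓ2 G ∧
  ∀ a, cnt ℓ2 G a 1 = cnt ℓ E a i ∧ cnt ℓ2 G a 2 = cnt ℓ E a (i + 1)

/-- `H` (with `ℓ2` columns) is the right-justified form `T[i,i+1]^*`. -/
def IsRJ2 (m ℓ : ℕ) (E : Arr) (i : ℕ) (H : Arr) (ℓ2 : ℕ) : Prop :=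
  IsPTab 2 m ℓ2 H ∧ RightJust 2 m ℓ2 H ∧
  ∀ a, cnt ℓ2 H a 1 = cnt ℓ E a i ∧ cnt ℓ2 H a 2 = cnt ℓ E a (i + 1)

/-- `PRaises n m ℓ i E E'` : `E' = e_i(E)` for ptableaux.  In `^*E[i,i+1]` the
right-most filled bottom box with a blank above it is located (column `c2`), and the
corresponding box of row `i+1` of `E` (column `c0`, same index from the left among
filled boxes of the row) is moved up into the blank above it. -/
def PRaises (n m ℓ i : ℕ) (E E' : Arr) : Prop :=
  IsPTab n m ℓ E ∧
  ∃ (G : Arr) (ℓ2 c2 c0 : ℕ), IsLJ2 m ℓ E i G ℓ2 ∧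
    c2 ∈ Finset.Icc 1 ℓ2 ∧ G 2 c2 ≠ none ∧ G 1 c2 = none ∧
    (∀ c', c' ∈ Finset.Icc 1 ℓ2 → G 2 c' ≠ none → G 1 c' = none → c' ≤ c2) ∧
    c0 ∈ Finset.Icc 1 ℓ ∧ E (i + 1) c0 ≠ none ∧ E i c0 = none ∧
    filledUpTo E (i + 1) c0 = filledUpTo G 2 c2 ∧
    E' = fun r c =>
      if r = i ∧ c = c0 then E (i + 1) c0
      else if r = i + 1 ∧ c = c0 then none
      else E r c

/-- `PLowers n m ℓ i E E'` : `E' = f_i(E)` for ptableaux. -/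
def PLowers (n m ℓ i : ℕ) (E E' : Arr) : Prop :=
  IsPTab n m ℓ E ∧
  ∃ (H : Arr) (ℓ2 c2 c0 : ℕ), IsRJ2 m ℓ E i H ℓ2 ∧
    c2 ∈ Finset.Icc 1 ℓ2 ∧ H 1 c2 ≠ none ∧ H 2 c2 = none ∧
    (∀ c', c' ∈ Finset.Icc 1 ℓ2 → H 1 c' ≠ none → H 2 c' = none → c2 ≤ c') ∧
    c0 ∈ Finset.Icc 1 ℓ ∧ E i c0 ≠ none ∧ E (i + 1) c0 = none ∧
    filledUpTo E i c0 = filledUpTo H 1 c2 ∧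
    E' = fun r c =>
      if r = i + 1 ∧ c = c0 then E i c0
      else if r = i ∧ c = c0 then none
      else E r c

/-- A ptableau is highest weight when no raising operator applies. -/
def PHighest (n m ℓ : ℕ) (E : Arr) : Prop :=
  ∀ i, 1 ≤ i → i < n → ¬∃ E', PRaises n m ℓ i E E'

/-- One application of some ptableau raising operator `e_i`, `1 ≤ i < n`. -/
def PRaiseStep (n m ℓ : ℕ) (E E' : Arr) : Prop :=
  ∃ i, 1 ≤ i ∧ i < n ∧ PRaises n m ℓ i E E'

/-- One application of some ptableau crystal operator `e_i` or `f_i`, `1 ≤ i < n`. -/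
def PStep (n m ℓ : ℕ) (E E' : Arr) : Prop :=
  ∃ i, 1 ≤ i ∧ i < n ∧ (PRaises n m ℓ i E E' ∨ PLowers n m ℓ i E E')

/-- Number of columns `s ∈ {1,…,k}` of the biword `(τ, ω)` equal to `(a, r)`. -/
def countPairs (k : ℕ) (τ ω : ℕ → ℕ) (a r : ℕ) : ℕ :=
  ((Finset.Icc 1 k).filter (fun s => τ s = a ∧ ω s = r)).card

/-- `E = Perf(τ, ω)` (up to row-equivalence): the ptableau with a box filled with
`τ_s` in row `ω_s` for each `s`. -/
def IsPerf (n m k ℓ : ℕ) (τ ω : ℕ → ℕ) (E : Arr) : Prop :=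
  IsPTab n m ℓ E ∧ ∀ a r, cnt ℓ E a r = countPairs k τ ω a r

/-- A (left-justified) array is a semistandard Young tableau: partition shape,
rows weakly increasing, columns strictly increasing. -/
def IsSSYT (E : Arr) : Prop :=
  (∀ r c, 1 ≤ c → E r (c + 1) ≠ none → E r c ≠ none) ∧
  (∀ r c, 1 ≤ r → E (r + 1) c ≠ none → E r c ≠ none) ∧
  (∀ r c c' a b, c ≤ c' → E r c = some a → E r c' = some b → a ≤ b) ∧
  (∀ r r' c a b, r < r' → E r c = some a → E r' c = some b → a < b)

/-- `D` (with `m` rows, content in `[n]`, `ℓd` columns) is the dual of the ptableau `E`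
(with `n` rows, content in `[m]`, `ℓ` columns): for each box of `E` filled with `i` in
row `j`, `D` has a box filled with `j` in row `i` (with multiplicity). -/
def IsDualOf (n m ℓ ℓd : ℕ) (E D : Arr) : Prop :=
  IsPTab n m ℓ E ∧ IsPTab m n ℓd D ∧ ∀ v r, cnt ℓd D v r = cnt ℓ E r v

/-- Rotation by 180° composed with the value flip `j ↦ m + 1 − j`. -/
def RotArr (n m ℓ : ℕ) (E : Arr) : Arr :=
  fun r c => (E (n + 1 - r) (ℓ + 1 - c)).map (fun j => m + 1 - j)

/-- The word condition for a ptableau with `n` rows. -/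
def WordCond (n ℓ : ℕ) (E : Arr) : Prop :=
  ∀ i k, 1 ≤ i → i + 1 ≤ n →
    ∑ r ∈ Finset.Icc (i + 1) (i + k + 1), cnt ℓ E (i + 1) r ≤
      ∑ r ∈ Finset.Icc i (i + k), cnt ℓ E i r

/-- `s'` is the value of the nearest filled box strictly above row `k` in column `col`
of `R` (`s' = 0` if there is no filled box above). -/
def NearestAbove (R : Arr) (k col s' : ℕ) : Prop :=
  (s' = 0 ∧ ∀ r, r < k → R r col = none) ∨
  (∃ r, r < k ∧ R r col = some s' ∧ ∀ r', r < r' → r' < k → R r' col = none)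

/-! ## Classic RSK via Schensted column insertion (tableaux stored as lists of columns) -/

/-- Insert `x` into a single column (stored top-to-bottom): replace the topmost entry
`≥ x` by `x`, returning the bumped entry; if none, append `x` at the bottom. -/
def bumpCol (x : ℕ) : List ℕ → Option ℕ × List ℕ
  | [] => (none, [x])
  | z :: rest =>
    if x ≤ z then (some z, x :: rest)
    else
      let p := bumpCol x rest
      (p.1, z :: p.2)

/-- Column-insert `x` into a tableau stored as a list of columns (left to right). -/
def insertTab : List (List ℕ) → ℕ → List (List ℕ)
  | [], x => [[x]]
  | col :: rest, x =>
    match bumpCol x col with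
    | (none, col') => col' :: rest
    | (some z, col') => col' :: insertTab rest z

/-- Grow the recording tableau `q` by placing `t` in the box where `pNew` grew from `pOld`. -/
def growQ : List (List ℕ) → List (List ℕ) → List (List ℕ) → ℕ → List (List ℕ)
  | pc :: pr, nc :: nr, qc :: qr, t =>
    if pc.length < nc.length then (qc ++ [t]) :: qr
    else qc :: growQ pr nr qr t
  | _, _, q, t => q ++ [[t]]

/-- One step of RSK: insert the biword column `tx = (τ_j, ω_j)`. -/
def rskStep (pq : List (List ℕ) × List (List ℕ)) (tx : ℕ × ℕ) :
    List (List ℕ) × List (List ℕ) :=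
  let P' := insertTab pq.1 tx.2
  (P', growQ pq.1 P' pq.2 tx.1)

/-- Classic RSK of a biword given as a list of columns `(τ_j, ω_j)`:
returns the pair (insertion tableau `P`, recording tableau `Q`), each stored
as a list of columns. -/
def rsk (bw : List (ℕ × ℕ)) : List (List ℕ) × List (List ℕ) :=
  bw.foldl rskStep ([], [])

/-- The list `[(τ 1, ω 1), …, (τ k, ω k)]` of columns of a biword. -/
def bwList (k : ℕ) (τ ω : ℕ → ℕ) : List (ℕ × ℕ) :=
  (List.range k).map (fun j => (τ (j + 1), ω (j + 1)))

/-- The entry in row `r`, column `c` (1-based) of a tableau stored as a list of columns. -/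
def tabEntry (cols : List (List ℕ)) : Arr := fun r c =>
  if 1 ≤ r ∧ 1 ≤ c then (cols.getD (c - 1) [])[r - 1]? else none

/-! # Maximal raising operators

`raiseMax i` applies `e_i` as often as possible.  These operators satisfy the relations of the
0-Hecke monoid, and the composite along a reduced word of the longest permutation sends a word to
its highest weight.  They act on infinite words compatibly with passing to initial factors. -/

section PartialSups

variable {D F : ℕ → ℤ}

/-- A sequence with upward steps at most one attains its running maximum at time `r` once more
just before exceeding it. -/
theorem exists_eq_partialSups_of_lt (hD : ∀ t, D (t + 1) ≤ D t + 1) {r t : ℕ} (hrt : r ≤ t)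
    (h : partialSups D r < partialSups D t) :
    ∃ s, r ≤ s ∧ s ≤ t ∧ D s = partialSups D r ∧ partialSups D s = partialSups D r := by
  induction t, hrt using Nat.le_induction with
  | base => exact absurd h (lt_irrefl _)
  | succ t hrt ih =>
    rcases (partialSups_monotone D hrt).lt_or_eq with h' | h'
    · obtain ⟨s, h1, h2, h3⟩ := ih h'
      exact ⟨s, h1, by omega, h3⟩
    · refine ⟨t, hrt, by omega, ?_, h'.symm⟩
      have h1 := hD t
      have h2 := le_partialSups_of_le D (le_refl t)
      rw [partialSups_add_one, lt_sup_iff] at h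
      omega

theorem partialSups_add_partialSups (hD : ∀ t, D (t + 1) ≤ D t + 1) (t : ℕ) :
    partialSups (fun u => D u + partialSups F u) t =
      partialSups D t + partialSups
        (fun u => D u - 2 * partialSups D u + partialSups (fun v => F v + partialSups D v) u) t := by
  apply le_antisymm
  · obtain ⟨s, hs, h⟩ := exists_partialSups_eq (fun u => D u + partialSups F u) t
    obtain ⟨r, hr, h'⟩ := exists_partialSups_eq F s
    rw [h]
    have key : ∀ q, r ≤ q → q ≤ t → D q - 2 * partialSups D q + (F r + partialSups D r) ≤
        partialSups (fun u => D u - 2 * partialSups D u +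
          partialSups (fun v => F v + partialSups D v) u) t := fun q hrq hqt =>
      le_trans (add_le_add_right (le_partialSups_of_le (fun v => F v + partialSups D v) hrq) _)
        (le_partialSups_of_le (fun u => D u - 2 * partialSups D u +
          partialSups (fun v => F v + partialSups D v) u) hqt)
    have h1 := le_partialSups_of_le D hs
    have h2 := partialSups_monotone D hs
    rcases (partialSups_monotone D (hr.trans hs)).lt_or_eq with h3 | h3
    · obtain ⟨q, hrq, hqt, h4, h5⟩ := exists_eq_partialSups_of_lt hD (hr.trans hs) h3
      have := key q hrq hqt
      omega
    · have := key s hr hs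
      omega
  · obtain ⟨s, hs, h⟩ := exists_partialSups_eq (fun u => D u - 2 * partialSups D u +
      partialSups (fun v => F v + partialSups D v) u) t
    obtain ⟨r, hr, h'⟩ := exists_partialSups_eq (fun v => F v + partialSups D v) s
    rw [h]
    have key : ∀ q, r ≤ q → q ≤ t → D q + F r ≤
        partialSups (fun u => D u + partialSups F u) t := fun q hrq hqt =>
      le_trans (add_le_add_right (le_partialSups_of_le F hrq) _)
        (le_partialSups_of_le (fun u => D u + partialSups F u) hqt)
    have h1 := le_partialSups_of_le D (le_refl s)
    have h2 := partialSups_monotone D hs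
    have h2' := partialSups_monotone D hr
    rcases (partialSups_monotone D (hr.trans hs)).lt_or_eq with h3 | h3
    · obtain ⟨q, hqt, h4⟩ := exists_partialSups_eq D t
      have hrq : r ≤ q := by
        by_contra! hlt
        have := le_partialSups_of_le D hlt.le
        omega
      have := key q hrq hqt
      omega
    · have := key s hr hs
      omega

end PartialSups

/-- The number of letters `a` among the first `t` letters of `w`. -/
def letterCount (w : ℕ → ℕ) (a t : ℕ) : ℤ := ∑ s ∈ Finset.Icc 1 t, phiL a (w s)

/-- The number of letters `i + 1` minus the number of letters `i` among the first `t`. -/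
def excess (w : ℕ → ℕ) (i t : ℕ) : ℤ := letterCount w (i + 1) t - letterCount w i t

/-- The number of `i`-unmatched letters `i + 1` among the first `t` letters of `w`. -/
def unmatched (w : ℕ → ℕ) (i t : ℕ) : ℤ := partialSups (excess w i) t

/-- Replace all `i`-unmatched letters `i + 1` of `w` by `i`. -/
def raiseMax (i : ℕ) (w : ℕ → ℕ) (s : ℕ) : ℕ :=
  if unmatched w i (s - 1) < unmatched w i s then i else w s

theorem letterCount_zero (w : ℕ → ℕ) (a : ℕ) : letterCount w a 0 = 0 := by simp [letterCount]

theorem letterCount_succ (w : ℕ → ℕ) (a t : ℕ) :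
    letterCount w a (t + 1) = letterCount w a t + if w (t + 1) = a then 1 else 0 := by
  rw [letterCount, Finset.sum_Icc_succ_top (by omega)]
  rfl

theorem ce_succ (w : ℕ → ℕ) (i t : ℕ) :
    ce w i (t + 1) = letterCount w (i + 1) (t + 1) - letterCount w i t := rfl

theorem excess_zero (w : ℕ → ℕ) (i : ℕ) : excess w i 0 = 0 := by simp [excess, letterCount_zero]

theorem excess_succ (w : ℕ → ℕ) (i t : ℕ) :
    excess w i (t + 1) = excess w i t + (if w (t + 1) = i + 1 then 1 else 0) -
      if w (t + 1) = i then 1 else 0 := by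
  simp only [excess, letterCount_succ]
  ring

theorem excess_succ_le (w : ℕ → ℕ) (i t : ℕ) : excess w i (t + 1) ≤ excess w i t + 1 := by
  rw [excess_succ]
  split_ifs <;> omega

theorem unmatched_zero (w : ℕ → ℕ) (i : ℕ) : unmatched w i 0 = 0 := by
  simp [unmatched, excess_zero]

theorem unmatched_succ (w : ℕ → ℕ) (i t : ℕ) :
    unmatched w i (t + 1) = max (unmatched w i t) (excess w i (t + 1)) :=
  partialSups_add_one _ _

theorem excess_le_unmatched (w : ℕ → ℕ) (i : ℕ) {s t : ℕ} (h : s ≤ t) :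
    excess w i s ≤ unmatched w i t := le_partialSups_of_le _ h

theorem unmatched_mono (w : ℕ → ℕ) (i : ℕ) {s t : ℕ} (h : s ≤ t) :
    unmatched w i s ≤ unmatched w i t := partialSups_monotone _ h

theorem unmatched_nonneg (w : ℕ → ℕ) (i t : ℕ) : 0 ≤ unmatched w i t :=
  (unmatched_zero w i).symm.trans_le (unmatched_mono w i t.zero_le)

theorem unmatched_le_iff {w : ℕ → ℕ} {i t : ℕ} {c : ℤ} :
    unmatched w i t ≤ c ↔ ∀ s ≤ t, excess w i s ≤ c := partialSups_le_iff

theorem raiseMax_zero (i : ℕ) (w : ℕ → ℕ) : raiseMax i w 0 = w 0 := by simp [raiseMax]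

/-- The action of `raiseMax` on letter counts. -/
theorem letterCount_raiseMax (i : ℕ) (w : ℕ → ℕ) (a t : ℕ) :
    letterCount (raiseMax i w) a t = letterCount w a t +
      if a = i then unmatched w i t else if a = i + 1 then -unmatched w i t else 0 := by
  induction t with
  | zero => simp [letterCount_zero, unmatched_zero]
  | succ t ih =>
    have h1 := excess_succ w i t
    have h2 := excess_le_unmatched w i (le_refl t)
    have h3 := unmatched_succ w i t
    rw [letterCount_succ, letterCount_succ, ih, raiseMax, Nat.add_sub_cancel]
    rcases le_or_gt (excess w i (t + 1)) (unmatched w i t) with h | h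
    · rw [max_eq_left h] at h3
      rw [h3, if_neg (lt_irrefl _)]
      ring
    · rw [max_eq_right h.le] at h3
      have hw : w (t + 1) = i + 1 := by
        by_contra hne
        rw [if_neg hne] at h1
        split_ifs at h1 <;> omega
      rw [h3, if_pos h, hw]
      rw [hw, if_pos rfl, if_neg (by omega)] at h1
      by_cases ha : a = i
      · simp [ha]
        omega
      · by_cases ha' : a = i + 1
        · simp [ha']
          omega
        · simp [ha, ha', Ne.symm ha, Ne.symm ha']

theorem eq_of_letterCount_eq {v w : ℕ → ℕ} (h0 : v 0 = w 0)
    (h : ∀ a t, letterCount v a t = letterCount w a t) : v = w := by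
  funext s
  cases s with
  | zero => exact h0
  | succ t =>
    have h1 := h (v (t + 1)) (t + 1)
    rw [letterCount_succ, letterCount_succ, h, if_pos rfl] at h1
    by_contra hne
    rw [if_neg (Ne.symm hne)] at h1
    omega

theorem unmatched_raiseMax_self (i : ℕ) (w : ℕ → ℕ) (t : ℕ) :
    unmatched (raiseMax i w) i t = 0 := by
  refine le_antisymm (unmatched_le_iff.2 fun s _ => ?_) (unmatched_nonneg _ _ _)
  have h1 := excess_le_unmatched w i (le_refl s)
  have h2 := unmatched_nonneg w i s
  simp only [excess, letterCount_raiseMax] at *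
  simp
  omega

theorem raiseMax_idem (i : ℕ) (w : ℕ → ℕ) : raiseMax i (raiseMax i w) = raiseMax i w := by
  funext s
  rw [raiseMax, unmatched_raiseMax_self, unmatched_raiseMax_self, if_neg (lt_irrefl _)]

theorem unmatched_raiseMax_of_far {i l : ℕ} (h : i + 2 ≤ l ∨ l + 2 ≤ i) (w : ℕ → ℕ) :
    unmatched (raiseMax i w) l = unmatched w l := by
  have : excess (raiseMax i w) l = excess w l := by
    funext t
    simp only [excess, letterCount_raiseMax]
    split_ifs <;> omega
  funext t
  rw [unmatched, this, unmatched]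

theorem raiseMax_comm {i l : ℕ} (h : i + 2 ≤ l ∨ l + 2 ≤ i) (w : ℕ → ℕ) :
    raiseMax i (raiseMax l w) = raiseMax l (raiseMax i w) := by
  refine eq_of_letterCount_eq (by simp only [raiseMax_zero]) fun a t => ?_
  simp only [letterCount_raiseMax, unmatched_raiseMax_of_far h, unmatched_raiseMax_of_far h.symm]
  ring

/-- The braid relation. -/
theorem raiseMax_braid (i : ℕ) (w : ℕ → ℕ) :
    raiseMax i (raiseMax (i + 1) (raiseMax i w)) =
      raiseMax (i + 1) (raiseMax i (raiseMax (i + 1) w)) := by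
  have e1 : ∀ v, excess (raiseMax i v) (i + 1) =
      fun t => excess v (i + 1) t + partialSups (excess v i) t := fun v => by
    funext t
    simp only [excess, letterCount_raiseMax, unmatched]
    split_ifs <;> omega
  have e2 : ∀ v, excess (raiseMax (i + 1) v) i =
      fun t => excess v i t + partialSups (excess v (i + 1)) t := fun v => by
    funext t
    simp only [excess, letterCount_raiseMax, unmatched]
    split_ifs <;> omega
  have e3 : ∀ v l, excess (raiseMax l v) l =
      fun t => excess v l t - 2 * partialSups (excess v l) t := fun v l => by
    funext t
    simp [excess, letterCount_raiseMax, unmatched]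
    ring
  have u1 : ∀ t, unmatched (raiseMax i w) (i + 1) t = unmatched w (i + 1) t +
      unmatched (raiseMax i (raiseMax (i + 1) w)) (i + 1) t := fun t => by
    simp only [unmatched, e1, e2, e3]
    exact partialSups_add_partialSups (excess_succ_le w (i + 1)) t
  have u2 : ∀ t, unmatched (raiseMax (i + 1) w) i t = unmatched w i t +
      unmatched (raiseMax (i + 1) (raiseMax i w)) i t := fun t => by
    simp only [unmatched, e1, e2, e3]
    exact partialSups_add_partialSups (excess_succ_le w i) t
  refine eq_of_letterCount_eq (by simp only [raiseMax_zero]) fun a t => ?_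
  have h1 := u1 t
  have h2 := u2 t
  simp only [letterCount_raiseMax]
  split_ifs <;> omega

/-- `raiseMax 1`, then `raiseMax 2`, and so on up to `raiseMax m`. -/
def raiseUpTo : ℕ → (ℕ → ℕ) → ℕ → ℕ
  | 0, w => w
  | m + 1, w => raiseMax (m + 1) (raiseUpTo m w)

/-- The composite of the operators `raiseMax 1`, …, `raiseMax m` along a reduced word of the
longest permutation. -/
def toHighest : ℕ → (ℕ → ℕ) → ℕ → ℕ
  | 0, w => w
  | m + 1, w => toHighest m (raiseUpTo (m + 1) w)

theorem raiseUpTo_raiseMax_of_lt {m i : ℕ} (h : m + 2 ≤ i) (w : ℕ → ℕ) :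
    raiseUpTo m (raiseMax i w) = raiseMax i (raiseUpTo m w) := by
  induction m with
  | zero => rfl
  | succ m ih => rw [raiseUpTo, raiseUpTo, ih (by omega), raiseMax_comm (Or.inl (by omega))]

theorem raiseUpTo_raiseMax_one (m : ℕ) (w : ℕ → ℕ) :
    raiseUpTo (m + 1) (raiseMax 1 w) = raiseUpTo (m + 1) w := by
  induction m with
  | zero => exact raiseMax_idem 1 w
  | succ m ih => rw [raiseUpTo, ih, ← raiseUpTo]

theorem raiseUpTo_raiseMax_succ {m i : ℕ} (hi : 1 ≤ i) (him : i < m) (w : ℕ → ℕ) :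
    raiseUpTo m (raiseMax (i + 1) w) = raiseMax i (raiseUpTo m w) := by
  induction m, him using Nat.le_induction with
  | base =>
    obtain ⟨l, rfl⟩ := Nat.exists_eq_add_of_le' hi
    simp only [raiseUpTo]
    rw [raiseUpTo_raiseMax_of_lt le_rfl, ← raiseMax_braid]
  | succ m him ih => rw [raiseUpTo, ih, raiseMax_comm (Or.inr (by omega)), ← raiseUpTo]

theorem toHighest_raiseMax {m i : ℕ} (hi : 1 ≤ i) (him : i ≤ m) (w : ℕ → ℕ) :
    toHighest m (raiseMax i w) = toHighest m w := by
  induction m generalizing i w with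
  | zero => omega
  | succ m ih =>
    obtain ⟨l, rfl⟩ := Nat.exists_eq_add_of_le' hi
    rw [toHighest, toHighest]
    cases l with
    | zero => rw [raiseUpTo_raiseMax_one]
    | succ l => rw [raiseUpTo_raiseMax_succ (by omega) (by omega), ih (by omega) (by omega)]

/-! ## Restriction to initial factors -/

/-- `v` and `w` have the same initial factor of length `k`. -/
def SamePrefix (k : ℕ) (v w : ℕ → ℕ) : Prop := ∀ s ∈ Finset.Icc 1 k, v s = w s

namespace SamePrefix

variable {k : ℕ} {u v w : ℕ → ℕ}

theorem symm (h : SamePrefix k v w) : SamePrefix k w v := fun s hs => (h s hs).symm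

theorem trans (h : SamePrefix k u v) (h' : SamePrefix k v w) : SamePrefix k u w :=
  fun s hs => (h s hs).trans (h' s hs)

theorem mono {j : ℕ} (hjk : j ≤ k) (h : SamePrefix k v w) : SamePrefix j v w :=
  fun s hs => h s (Finset.Icc_subset_Icc_right hjk hs)

theorem letterCount_eq (h : SamePrefix k v w) (a : ℕ) {t : ℕ} (ht : t ≤ k) :
    letterCount v a t = letterCount w a t :=
  Finset.sum_congr rfl fun s hs => by rw [h.mono ht s hs]

theorem unmatched_eq (h : SamePrefix k v w) (i : ℕ) {t : ℕ} (ht : t ≤ k) :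
    unmatched v i t = unmatched w i t := by
  induction t with
  | zero => rw [unmatched_zero, unmatched_zero]
  | succ t ih =>
    rw [unmatched_succ, unmatched_succ, ih (by omega), excess, excess, h.letterCount_eq _ ht,
      h.letterCount_eq _ ht]

theorem raiseMax (h : SamePrefix k v w) (i : ℕ) :
    SamePrefix k (raiseMax i v) (raiseMax i w) := fun s hs => by
  have := Finset.mem_Icc.1 hs
  rw [_root_.raiseMax, _root_.raiseMax, h.unmatched_eq i this.2, h.unmatched_eq i (by omega),
    h s hs]

theorem raiseUpTo (h : SamePrefix k v w) (m : ℕ) :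
    SamePrefix k (raiseUpTo m v) (raiseUpTo m w) := by
  induction m with
  | zero => exact h
  | succ m ih => exact ih.raiseMax (m + 1)

theorem toHighest (h : SamePrefix k v w) (m : ℕ) :
    SamePrefix k (toHighest m v) (toHighest m w) := by
  induction m generalizing v w with
  | zero => exact h
  | succ m ih => exact ih (h.raiseUpTo (m + 1))

end SamePrefix

/-! ## Comparison with the raising operators -/

theorem letterCount_update {w : ℕ → ℕ} {p i : ℕ} (hp : 1 ≤ p) (hw : w p = i + 1) (a t : ℕ) :
    letterCount (Function.update w p i) a t = letterCount w a t +
      if p ≤ t then (if a = i then 1 else 0) - (if a = i + 1 then 1 else 0) else 0 := by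
  induction t with
  | zero => simp [letterCount_zero, show p ≠ 0 by omega]
  | succ t ih =>
    rw [letterCount_succ, letterCount_succ, ih]
    by_cases h : t + 1 = p
    · subst h
      simp only [Function.update_self, hw]
      split_ifs <;> omega
    · rw [Function.update_of_ne h]
      split_ifs <;> omega

theorem Raises.samePrefix_raiseMax {k i : ℕ} {w w' : ℕ → ℕ} (h : Raises k i w w') :
    SamePrefix k (raiseMax i w') (raiseMax i w) := by
  obtain ⟨E, p, ⟨-, hE⟩, hp, hpE, hmin, hw, rfl⟩ := h
  rw [Finset.mem_Icc] at hp
  obtain ⟨q, rfl⟩ := Nat.exists_eq_add_of_le' hp.1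
  have hle : ∀ s, s + 1 ≤ k → excess w i (s + 1) ≤ ce w i (s + 1) := fun s _ => by
    rw [ce_succ, excess, letterCount_succ w i]
    split_ifs <;> omega
  have hlt : ∀ s ≤ q, excess w i s ≤ E - 1 := fun s hs => by
    cases s with
    | zero =>
      rw [excess_zero]
      cases q with
      | zero =>
        rw [ce_succ, letterCount_succ, if_pos hw, letterCount_zero, letterCount_zero] at hpE
        omega
      | succ q =>
        have h1 := hle 0 (by omega)
        have h2 := hE 1 (Finset.mem_Icc.2 ⟨le_rfl, by omega⟩)
        have h3 := hmin 1 (Finset.mem_Icc.2 ⟨le_rfl, by omega⟩)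
        have h4 : 0 ≤ ce w i 1 := by
          rw [ce_succ, letterCount_succ, letterCount_zero, letterCount_zero]
          split_ifs <;> omega
        have h5 : ce w i 1 ≠ E := fun h => by have := h3 h; omega
        omega
    | succ s =>
      have h1 := hle s (by omega)
      have hs' : s + 1 ∈ Finset.Icc 1 k := Finset.mem_Icc.2 ⟨by omega, by omega⟩
      have h2 := hE _ hs'
      have h5 : ce w i (s + 1) ≠ E := fun h => by have := hmin _ hs' h; omega
      omega
  have hex : excess w i (q + 1) = E := by
    rw [← hpE, ce_succ, excess, letterCount_succ w i, if_neg (by omega), add_zero]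
  have hexq : excess w i q = E - 1 := by
    have := excess_succ_le w i q
    have := hlt q le_rfl
    omega
  have hup : ∀ t, excess (Function.update w (q + 1) i) i t =
      excess w i t - if q + 1 ≤ t then 2 else 0 := fun t => by
    simp only [excess, letterCount_update hp.1 hw]
    split_ifs <;> omega
  have hu : ∀ t ≤ k, unmatched w i t = unmatched (Function.update w (q + 1) i) i t +
      (if q + 1 ≤ t then 1 else 0) ∧ (t = q → unmatched w i t = E - 1) ∧
      (q + 1 ≤ t → unmatched w i t = E) := fun t ht => by
    induction t with
    | zero =>
      refine ⟨by simp [unmatched_zero], fun h => ?_, by omega⟩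
      rw [← hexq, ← h, unmatched_zero, excess_zero]
    | succ t ih =>
      obtain ⟨h1, h2, h3⟩ := ih (by omega)
      have h4 := hup (t + 1)
      have h5 := unmatched_succ w i t
      have h6 := unmatched_succ (Function.update w (q + 1) i) i t
      have h7 := (hle t ht).trans (hE _ (Finset.mem_Icc.2 ⟨by omega, ht⟩))
      rcases lt_trichotomy t q with h | rfl | h
      · rw [if_neg (by omega)] at h1 h4 ⊢
        refine ⟨by rw [h5, h6, h4, h1]; simp, fun h => ?_, by omega⟩
        subst h
        refine le_antisymm (unmatched_le_iff.2 hlt) ?_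
        rw [← hexq]
        exact excess_le_unmatched _ _ le_rfl
      · rw [if_neg (by omega)] at h1
        rw [if_pos le_rfl] at h4 ⊢
        have := h2 rfl
        refine ⟨?_, by omega, fun _ => ?_⟩ <;> omega
      · rw [if_pos (by omega)] at h1 h4 ⊢
        have := h3 (by omega)
        refine ⟨?_, by omega, fun _ => ?_⟩ <;> omega
  intro s hs
  rw [Finset.mem_Icc] at hs
  obtain ⟨h1, h2, h3⟩ := hu s hs.2
  obtain ⟨h1', h2', h3'⟩ := hu (s - 1) (by omega)
  rw [raiseMax, raiseMax]
  by_cases h : s = q + 1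
  · subst h
    rw [Function.update_self, ite_self, if_pos]
    rw [h2' rfl, h3 le_rfl]
    omega
  · rw [Function.update_of_ne h]
    congr 1
    apply propext
    split_ifs at h1 h1' <;> omega

theorem samePrefix_raiseMax_of_not_raises {k i : ℕ} {w : ℕ → ℕ} (h : ¬∃ w', Raises k i w w') :
    SamePrefix k (raiseMax i w) w := by
  suffices hk : unmatched w i k ≤ 0 by
    intro s hs
    rw [Finset.mem_Icc] at hs
    have h1 := unmatched_mono w i hs.2
    have h2 := unmatched_nonneg w i (s - 1)
    rw [raiseMax, if_neg (by omega)]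
  by_contra! hpos
  apply h
  obtain ⟨r, hr, hr'⟩ := exists_partialSups_eq (excess w i) k
  change unmatched w i k = _ at hr'
  have hr1 : 1 ≤ r := by
    by_contra! h0
    obtain rfl : r = 0 := by omega
    rw [excess_zero] at hr'
    omega
  obtain ⟨q, hq, hqmax⟩ := Finset.exists_max_image (Finset.Icc 1 k) (ce w i)
    ⟨r, Finset.mem_Icc.2 ⟨hr1, hr⟩⟩
  obtain ⟨p, hp, hpmin⟩ := Finset.exists_min_image
    ((Finset.Icc 1 k).filter fun s => ce w i s = ce w i q) id
    ⟨q, Finset.mem_filter.2 ⟨hq, rfl⟩⟩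
  rw [Finset.mem_filter] at hp
  refine ⟨_, ce w i q, p, ⟨⟨q, hq, rfl⟩, hqmax⟩, hp.1, hp.2,
    fun s hs hsE => hpmin s (Finset.mem_filter.2 ⟨hs, hsE⟩), ?_, rfl⟩
  have hE : 0 < ce w i p := by
    have h1 := hqmax r (Finset.mem_Icc.2 ⟨hr1, hr⟩)
    obtain ⟨r, rfl⟩ := Nat.exists_eq_add_of_le' hr1
    have h2 : excess w i (r + 1) ≤ ce w i (r + 1) := by
      rw [ce_succ, excess, letterCount_succ w i]
      split_ifs <;> omega
    omega
  have hp1 := Finset.mem_Icc.1 hp.1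
  obtain ⟨t, rfl⟩ := Nat.exists_eq_add_of_le' hp1.1
  by_contra hne
  rw [ce_succ, letterCount_succ, if_neg hne] at hE
  cases t with
  | zero => simp [letterCount_zero] at hE
  | succ t =>
    have ht : t + 1 ∈ Finset.Icc 1 k := Finset.mem_Icc.2 ⟨by omega, by omega⟩
    have h1 := hqmax _ ht
    have h2 : ce w i (t + 1) ≠ ce w i q := fun h => by
      have := hpmin _ (Finset.mem_filter.2 ⟨ht, h⟩)
      simp at this
    rw [← hp.2] at h1 h2
    rw [ce_succ, ce_succ w i (t + 1), letterCount_succ w (i + 1) (t + 1), if_neg hne,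
      letterCount_succ w i t] at h1 h2
    split_ifs at h1 h2 <;> omega

theorem samePrefix_toHighest_of_fixed {k m : ℕ} {w : ℕ → ℕ}
    (h : ∀ i, 1 ≤ i → i ≤ m → SamePrefix k (raiseMax i w) w) :
    SamePrefix k (toHighest m w) w := by
  have hC : ∀ l ≤ m, SamePrefix k (raiseUpTo l w) w := fun l hl => by
    induction l with
    | zero => exact fun _ _ => rfl
    | succ l ih => exact ((ih (by omega)).raiseMax _).trans (h _ (by omega) hl)
  induction m with
  | zero => exact fun _ _ => rfl
  | succ m ih =>
    exact ((hC _ le_rfl).toHighest m).trans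
      (ih (fun i hi him => h i hi (by omega)) fun l hl => hC l (by omega))

/-- A highest weight of a word is its image under `toHighest`. -/
theorem HighestOf.samePrefix_toHighest {n k : ℕ} {w η : ℕ → ℕ} (h : HighestOf n k w η) :
    SamePrefix k (toHighest (n - 1) w) η := by
  obtain ⟨hsteps, hhigh⟩ := h
  refine SamePrefix.trans ?_ (samePrefix_toHighest_of_fixed (m := n - 1) fun i hi him =>
    samePrefix_raiseMax_of_not_raises (hhigh i hi (by omega)))
  clear hhigh
  induction hsteps with
  | refl => exact fun _ _ => rfl
  | tail _ hstep ih =>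
    obtain ⟨i, hi, hin, hr⟩ := hstep
    have := (hr.samePrefix_raiseMax.toHighest (n - 1)).symm
    rw [toHighest_raiseMax hi (by omega), toHighest_raiseMax hi (by omega)] at this
    exact ih.trans this

/-- if `η` is a highest weight of `w` (length `k`) and `η'` is a highest
weight of the initial factor `w_1 ⋯ w_j` (`1 ≤ j < k`), then `η'` is the initial
factor of `η` of length `j`. -/
theorem stmt3 (n k j : ℕ) (hn : 2 ≤ n) (hj : 1 ≤ j) (hjk : j < k)
    (w η η' : ℕ → ℕ) (hw : IsWord n k w)
    (h1 : HighestOf n k w η) (h2 : HighestOf n j w η') :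
    ∀ s ∈ Finset.Icc 1 j, η' s = η s := by
  exact ((h1.samePrefix_toHighest.mono hjk.le).symm.trans h2.samePrefix_toHighest).symm
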